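/- The sequence (1/n)·ln(V_n) converges as n → ∞, and its limit equals ln(α₂), where α₂ = (1/3)·( 11 + ((1825 − 3·√921)/2)^{1/3} + ((1825 + 3·√921)/2)^{1/3} ), with real cube roots and real square root (note 1825 − 3·√921 > 0). -/

import Mathlib

open Pointwise

/-- The polytope `Q_n ⊆ ℝ^{3×n}`: the Minkowski sum of the `2(n−1)` simplices
`Δ_{i,j} = conv{e_{i,j}, e_{i,j+1}, e_{i+1,j}, e_{i+1,j+1}}` for `0 ≤ i ≤ 1`, `0 ≤ j ≤ n−2`. -/
noncomputable def Qpolytope (n : ℕ) : Set (Fin 3 × Fin n → ℝ) :=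
  ∑ i : Fin 2, ∑ j : Fin (n - 1),
    convexHull ℝ
      ({Pi.single (Fin.castSucc i, ⟨j.1, by have := j.isLt; omega⟩) (1 : ℝ),
        Pi.single (Fin.castSucc i, ⟨j.1 + 1, by have := j.isLt; omega⟩) (1 : ℝ),
        Pi.single (Fin.succ i, ⟨j.1, by have := j.isLt; omega⟩) (1 : ℝ),
        Pi.single (Fin.succ i, ⟨j.1 + 1, by have := j.isLt; omega⟩) (1 : ℝ)} :
        Set (Fin 3 × Fin n → ℝ))

/-- `V_n`, the number of vertices (extreme points) of `Q_n`. -/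
noncomputable def numVerticesQ (n : ℕ) : ℕ :=
  Nat.card (Set.extremePoints ℝ (Qpolytope n))

theorem mem_extremePoints_of_sum_mem_extremePoints {K E : Type*} [Fintype K]
    [AddCommGroup E] [Module ℝ E] {S : K → Set E} {g : K → E} (hg : ∀ k, g k ∈ S k)
    (hx : ∑ k, g k ∈ Set.extremePoints ℝ (∑ k, S k)) (k : K) :
    g k ∈ Set.extremePoints ℝ (S k) := by
  classical
  rw [mem_extremePoints_iff_left] at hx ⊢
  have hupd (y : E) : ∑ i, Function.update g k y i = y + ∑ i ∈ Finset.univ \ {k}, g i :=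
    Finset.sum_update_of_mem (Finset.mem_univ k) g y
  have hmem {y : E} (hy : y ∈ S k) : ∑ i, Function.update g k y i ∈ ∑ i, S i := by
    refine Set.finsetSum_mem_finsetSum _ _ _ fun i _ => ?_
    by_cases hi : i = k
    · subst hi
      simp [hy]
    · simp [hi, hg i]
  have hself : ∑ i, g i = g k + ∑ i ∈ Finset.univ \ {k}, g i := by
    simp
  refine ⟨hg k, fun y hy z hz hyz => ?_⟩
  obtain ⟨a, b, ha, hb, hab, hk⟩ := hyz
  have h := hx.2 _ (hmem hy) _ (hmem hz) ⟨a, b, ha, hb, hab, by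
    rw [hupd, hupd, hself, ← hk, smul_add, smul_add, add_add_add_comm, ← add_smul, hab, one_smul]⟩
  rw [hupd, hself] at h
  exact add_right_cancel h

theorem eq_of_sum_mem_extremePoints {K E : Type*} [Fintype K] [AddCommGroup E] [Module ℝ E]
    {S : K → Set E} (hS : ∀ k, Convex ℝ (S k)) {g g' : K → E} (hg : ∀ k, g k ∈ S k)
    (hg' : ∀ k, g' k ∈ S k) (hx : ∑ k, g k ∈ Set.extremePoints ℝ (∑ k, S k))
    (h : ∑ k, g k = ∑ k, g' k) : g = g' := by
  have hsum : ∑ k, ((1 / 2 : ℝ) • g k + (1 / 2 : ℝ) • g' k) = ∑ k, g k := by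
    rw [Finset.sum_add_distrib, ← Finset.smul_sum, ← Finset.smul_sum, ← h, ← add_smul]
    norm_num
  funext k
  have hk := mem_extremePoints_of_sum_mem_extremePoints
    (g := fun k => (1 / 2 : ℝ) • g k + (1 / 2 : ℝ) • g' k)
    (fun k => hS k (hg k) (hg' k) (by norm_num) (by norm_num) (by norm_num)) (hsum ▸ hx) k
  have := (mem_extremePoints.1 hk).2 _ (hg k) _ (hg' k)
    ⟨1 / 2, 1 / 2, by norm_num, by norm_num, by norm_num, rfl⟩
  exact this.1.trans this.2.symm

section SimplexSum

variable {K L C : Type*} (cell : K → L → C)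

/-- In each simplex the weights `w` are maximized exactly at the chosen vertex. -/
def Realizes (f : K → L) (w : C → ℝ) : Prop :=
  ∀ k l, l ≠ f k → w (cell k l) < w (cell k (f k))

variable {cell}

theorem Realizes.le {f : K → L} {w : C → ℝ} (h : Realizes cell f w) (k : K) (l : L) :
    w (cell k l) ≤ w (cell k (f k)) := by
  by_cases hl : l = f k
  · rw [hl]
  · exact (h k l hl).le

/-- The comparisons between cells forced by the choice `f`. -/
def choiceRel (cell : K → L → C) (f : K → L) (c' c : C) : Prop :=
  ∃ k l, l ≠ f k ∧ c' = cell k l ∧ c = cell k (f k)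

variable [DecidableEq C]

/-- The vertex of the `k`-th simplex indexed by `l`. -/
def simplexVertex (cell : K → L → C) (k : K) (l : L) : C → ℝ := Pi.single (cell k l) 1

/-- The Minkowski sum of the coordinate simplices given by `cell`. -/
def simplexSum [Fintype K] (cell : K → L → C) : Set (C → ℝ) :=
  ∑ k, convexHull ℝ (Set.range (simplexVertex cell k))

theorem dotProduct_simplexVertex [Fintype C] (w : C → ℝ) (k : K) (l : L) :
    w ⬝ᵥ simplexVertex cell k l = w (cell k l) := by
  simp [simplexVertex]

theorem Realizes.dotProduct_lt_or_eq [Fintype C] {f : K → L} {w : C → ℝ}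
    (h : Realizes cell f w) {k : K}
    {y : C → ℝ} (hy : y ∈ convexHull ℝ (Set.range (simplexVertex cell k))) :
    w ⬝ᵥ y < w (cell k (f k)) ∨ y = simplexVertex cell k (f k) := by
  refine convexHull_min (t := {y | w ⬝ᵥ y < w (cell k (f k)) ∨ y = simplexVertex cell k (f k)})
    ?_ ?_ hy
  · rintro _ ⟨l, rfl⟩
    by_cases hl : l = f k
    · exact Or.inr (by rw [hl])
    · exact Or.inl (by rw [dotProduct_simplexVertex]; exact h k l hl)
  · have hp := dotProduct_simplexVertex (cell := cell) w k (f k)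
    intro x hx y hy a b ha hb hab
    simp only [Set.mem_ofPred_eq, dotProduct_add, dotProduct_smul, smul_eq_mul] at hx hy ⊢
    obtain rfl | ha := ha.eq_or_lt
    · obtain rfl : b = 1 := by linarith
      simpa using hy
    obtain rfl | hb := hb.eq_or_lt
    · obtain rfl : a = 1 := by linarith
      simpa using hx
    obtain rfl : b = 1 - a := by linarith
    rcases hx with hx | rfl
    · left
      have : w ⬝ᵥ y ≤ w (cell k (f k)) := by
        rcases hy with hy | rfl
        · exact hy.le
        · exact hp.le
      nlinarith
    · rcases hy with hy | rfl
      · left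
        rw [hp]
        nlinarith
      · right
        rw [← add_smul, hab, one_smul]

theorem Realizes.eq_of_le_dotProduct [Fintype K] [Fintype C] {f : K → L} {w : C → ℝ}
    (h : Realizes cell f w)
    {x : C → ℝ} (hx : x ∈ simplexSum cell)
    (hle : ∑ k, w (cell k (f k)) ≤ w ⬝ᵥ x) : x = ∑ k, simplexVertex cell k (f k) := by
  obtain ⟨g, hg, rfl⟩ := (Set.mem_fintype_sum _ _).1 hx
  rw [dotProduct_sum] at hle
  have hle' (k : K) : w ⬝ᵥ g k ≤ w (cell k (f k)) := by
    rcases h.dotProduct_lt_or_eq (hg k) with hk | hk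
    · exact hk.le
    · rw [hk, dotProduct_simplexVertex]
  refine Finset.sum_congr rfl fun k _ => (h.dotProduct_lt_or_eq (hg k)).resolve_left fun hk => ?_
  exact hle.not_gt (Finset.sum_lt_sum (fun k _ => hle' k) ⟨k, Finset.mem_univ k, hk⟩)

theorem dotProduct_sum_simplexVertex [Fintype K] [Fintype C] (w : C → ℝ) (f : K → L) :
    w ⬝ᵥ ∑ k, simplexVertex cell k (f k) = ∑ k, w (cell k (f k)) := by
  simp only [dotProduct_sum, dotProduct_simplexVertex]

theorem sum_simplexVertex_mem [Fintype K] (f : K → L) :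
    ∑ k, simplexVertex cell k (f k) ∈ simplexSum cell :=
  Set.finsetSum_mem_finsetSum _ _ _ fun _ _ => subset_convexHull ℝ _ ⟨_, rfl⟩

theorem Realizes.sum_mem_extremePoints [Fintype K] [Fintype C] {f : K → L} {w : C → ℝ}
    (h : Realizes cell f w) :
    ∑ k, simplexVertex cell k (f k) ∈ Set.extremePoints ℝ (simplexSum cell) := by
  rw [mem_extremePoints_iff_left]
  refine ⟨sum_simplexVertex_mem f, fun x hx y hy hxy => h.eq_of_le_dotProduct hx ?_⟩
  obtain ⟨a, b, ha, hb, hab, heq⟩ := hxy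
  have hval := congrArg (w ⬝ᵥ ·) heq
  simp only [dotProduct_add, dotProduct_smul, smul_eq_mul, dotProduct_sum_simplexVertex] at hval
  by_contra! hlt
  have hyle : w ⬝ᵥ y ≤ ∑ k, w (cell k (f k)) := by
    by_contra! hy'
    have := h.eq_of_le_dotProduct hy hy'.le
    rw [this, dotProduct_sum_simplexVertex] at hy'
    exact lt_irrefl _ hy'
  obtain rfl : b = 1 - a := by linarith
  nlinarith

theorem Realizes.eq_of_sum_eq [Fintype K] [Fintype C] {f g : K → L} {w : C → ℝ}
    (h : Realizes cell f w)
    (hfg : ∑ k, simplexVertex cell k (f k) = ∑ k, simplexVertex cell k (g k)) : f = g := by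
  have hval := congrArg (w ⬝ᵥ ·) hfg
  simp only [dotProduct_sum_simplexVertex] at hval
  funext k
  by_contra hk
  exact hval.not_gt (Finset.sum_lt_sum (fun k _ => h.le k (g k))
    ⟨k, Finset.mem_univ k, h k (g k) (Ne.symm hk)⟩)

theorem exists_displacement [Fintype K] [Fintype L] {f : K → L} {a b : C}
    (h : Relation.TransGen (choiceRel cell f) a b) :
    ∃ t : K → L → ℝ, (∀ k l, 0 ≤ t k l) ∧ (∃ k l, l ≠ f k ∧ 0 < t k l) ∧
      ∑ k, ∑ l, t k l • (simplexVertex cell k l - simplexVertex cell k (f k)) =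
        (Pi.single a 1 - Pi.single b 1 : C → ℝ) := by
  classical
  have base {a b : C} (h : choiceRel cell f a b) :
      ∃ t : K → L → ℝ, (∀ k l, 0 ≤ t k l) ∧ (∃ k l, l ≠ f k ∧ 0 < t k l) ∧
      ∑ k, ∑ l, t k l • (simplexVertex cell k l - simplexVertex cell k (f k)) =
        (Pi.single a 1 - Pi.single b 1 : C → ℝ) := by
    obtain ⟨k, l, hl, rfl, rfl⟩ := h
    refine ⟨fun k' l' => if k' = k ∧ l' = l then 1 else 0, fun _ _ => by positivity,
      ⟨k, l, hl, by simp⟩, ?_⟩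
    rw [Finset.sum_eq_single k (by intro i _ hi; simp [hi]) (by simp),
      Finset.sum_eq_single l (by intro i _ hi; simp [hi]) (by simp)]
    simp [simplexVertex]
  induction h with
  | single h => exact base h
  | tail _ h ih =>
    obtain ⟨t, ht0, ⟨k, l, hl, hkl⟩, ht⟩ := ih
    obtain ⟨u, hu0, -, hu⟩ := base h
    refine ⟨t + u, fun k l => add_nonneg (ht0 k l) (hu0 k l),
      ⟨k, l, hl, add_pos_of_pos_of_nonneg hkl (hu0 k l)⟩, ?_⟩
    simp only [Pi.add_apply, add_smul, Finset.sum_add_distrib, ht, hu]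
    abel

theorem exists_realizes_of_mem_extremePoints [Fintype K] [Fintype L] [Fintype C]
    (hcell : ∀ k, Function.Injective (cell k))
    {f : K → L} (hf : ∑ k, simplexVertex cell k (f k) ∈ Set.extremePoints ℝ (simplexSum cell)) :
    ∃ w, Realizes cell f w := by
  have hirr (c : C) : ¬ Relation.TransGen (choiceRel cell f) c c := by
    intro hc
    obtain ⟨t, ht0, ⟨k₀, l₀, hl₀, hpos⟩, ht⟩ := exists_displacement hc
    rw [sub_self] at ht
    set N : ℝ := 1 + ∑ k, ∑ l, t k l with hN
    have hk0 (k : K) : 0 ≤ ∑ l, t k l := Finset.sum_nonneg fun l _ => ht0 k l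
    have hkN (k : K) : ∑ l, t k l ≤ N := by
      have := Finset.single_le_sum (fun k _ => hk0 k) (Finset.mem_univ k)
      linarith
    have hN0 : 0 < N := by
      have := Finset.sum_nonneg fun k (_ : k ∈ Finset.univ) => hk0 k
      linarith
    set D : K → C → ℝ :=
      fun k => ∑ l, t k l • (simplexVertex cell k l - simplexVertex cell k (f k)) with hD
    have heq := eq_of_sum_mem_extremePoints
      (S := fun k => convexHull ℝ (Set.range (simplexVertex cell k)))
      (g := fun k => simplexVertex cell k (f k))
      (g' := fun k => simplexVertex cell k (f k) + N⁻¹ • D k)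
      (fun k => convex_convexHull ℝ _) (fun k => subset_convexHull ℝ _ ⟨_, rfl⟩) (fun k => ?_) hf
      (by rw [Finset.sum_add_distrib, ← Finset.smul_sum, ht, smul_zero, add_zero])
    · have hz : D k₀ = 0 := by
        have h := congrFun heq k₀
        simpa [hN0.ne'] using h
      have hz' := congrFun hz (cell k₀ l₀)
      simp only [hD, Finset.sum_apply, Pi.smul_apply, Pi.sub_apply, simplexVertex,
        Pi.zero_apply, smul_eq_mul] at hz'
      rw [Finset.sum_eq_single l₀ (fun l _ hl => by simp [(hcell k₀).ne hl.symm,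
        (hcell k₀).ne hl₀]) (by simp)] at hz'
      simp [(hcell k₀).ne hl₀] at hz'
      exact hpos.ne' hz'
    · have hmem : (1 - N⁻¹ * ∑ l, t k l) • simplexVertex cell k (f k) +
          ∑ l, (N⁻¹ * t k l) • simplexVertex cell k l ∈
            convexHull ℝ (Set.range (simplexVertex cell k)) := by
        have := (convex_convexHull ℝ (Set.range (simplexVertex cell k))).sum_mem
          (t := (Finset.univ : Finset (Option L)))
          (w := fun o => o.elim (1 - N⁻¹ * ∑ l, t k l) fun l => N⁻¹ * t k l)
          (z := fun o => o.elim (simplexVertex cell k (f k)) (simplexVertex cell k))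
          (by
            rintro (_ | l) -
            · have := (inv_mul_le_one₀ hN0).2 (hkN k)
              simpa using this
            · exact mul_nonneg (inv_nonneg.2 hN0.le) (ht0 k l))
          (by simp [Fintype.sum_option, Finset.mul_sum])
          (by
            rintro (_ | l) -
            · exact subset_convexHull ℝ _ ⟨_, rfl⟩
            · exact subset_convexHull ℝ _ ⟨_, rfl⟩)
        simpa [Fintype.sum_option] using this
      convert hmem using 1
      simp only [hD, smul_sub, Finset.sum_sub_distrib, ← Finset.sum_smul, mul_smul,
        ← Finset.smul_sum, sub_smul, one_smul]
      abel
  refine ⟨fun c => (Set.ncard {c' | Relation.TransGen (choiceRel cell f) c' c} : ℝ),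
    fun k l hl => ?_⟩
  have hrel : choiceRel cell f (cell k l) (cell k (f k)) := ⟨k, l, hl, rfl, rfl⟩
  exact Nat.cast_lt.2 (Set.ncard_lt_ncard
    ⟨fun c hc => Relation.TransGen.tail hc hrel, fun hsub => hirr _ (hsub (.single hrel))⟩
    (Set.toFinite _))

theorem card_extremePoints_simplexSum [Fintype K] [Fintype L] [Fintype C]
    (hcell : ∀ k, Function.Injective (cell k)) :
    Nat.card (Set.extremePoints ℝ (simplexSum cell)) =
      Nat.card {f : K → L // ∃ w, Realizes cell f w} := by
  symm
  refine Nat.card_congr (Equiv.ofBijective (fun f => ⟨∑ k, simplexVertex cell k (f.1 k),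
    f.2.choose_spec.sum_mem_extremePoints⟩) ⟨fun f g hfg => ?_, fun x => ?_⟩)
  · exact Subtype.ext (f.2.choose_spec.eq_of_sum_eq (congrArg Subtype.val hfg))
  · obtain ⟨x, hx⟩ := x
    obtain ⟨g, hg, rfl⟩ := (Set.mem_fintype_sum _ _).1 hx.1
    have h (k : K) : g k ∈ Set.range (simplexVertex cell k) :=
      extremePoints_convexHull_subset (mem_extremePoints_of_sum_mem_extremePoints hg hx k)
    choose f hf using h
    obtain rfl : (fun k => simplexVertex cell k (f k)) = g := funext hf
    exact ⟨⟨f, exists_realizes_of_mem_extremePoints hcell hx⟩, rfl⟩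

end SimplexSum

/-- Weights `w` respecting the strict comparisons prescribed by the Boolean relation `R`. -/
def Sat {ι : Type*} (R : ι → ι → Bool) (w : ι → ℝ) : Prop :=
  ∀ i j, R i j = true → w i < w j

/-- Fourier–Motzkin elimination of the node `k` from the strict comparisons `R`. -/
def elimNode {ι : Type*} [DecidableEq ι] (k : ι) (R : ι → ι → Bool) (i j : ι) : Bool :=
  !decide (i = k) && (!decide (j = k) && (R i j || (R i k && R k j) || R k k))

/-- One step of the Floyd–Warshall transitive closure. -/
def closeNode {ι : Type*} (k : ι) (R : ι → ι → Bool) (i j : ι) : Bool :=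
  R i j || (R i k && R k j)

theorem exists_sat_update_iff {ι : Type*} [Fintype ι] [DecidableEq ι] (R : ι → ι → Bool)
    {k i₀ : ι} (h : i₀ ≠ k) (w : ι → ℝ) :
    (∃ x, Sat R (Function.update w k x)) ↔ Sat (elimNode k R) w := by
  constructor
  · rintro ⟨x, hx⟩ i j hij
    simp only [elimNode, Bool.and_eq_true, Bool.or_eq_true, Bool.not_eq_true',
      decide_eq_false_iff_not] at hij
    obtain ⟨hi, hj, (h1 | ⟨h1, h2⟩) | h1⟩ := hij
    · simpa [hi, hj] using hx _ _ h1
    · have a := hx _ _ h1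
      have b := hx _ _ h2
      simp only [Function.update_self, ne_eq, hi, hj, not_false_eq_true,
        Function.update_of_ne] at a b
      exact a.trans b
    · exact absurd (hx _ _ h1) (lt_irrefl _)
  · intro hw
    have hk : R k k = false := by
      by_contra hk
      exact lt_irrefl _ (hw i₀ i₀ (by simp_all [elimNode]))
    obtain ⟨x, hlo, hhi⟩ := Order.exists_between_finsets
      ((Finset.univ.filter fun i => i ≠ k ∧ R i k = true).image w)
      ((Finset.univ.filter fun j => j ≠ k ∧ R k j = true).image w) (by
        intro a ha b hb
        simp only [Finset.mem_image, Finset.mem_filter, Finset.mem_univ, true_and] at ha hb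
        obtain ⟨i, ⟨hi, hik⟩, rfl⟩ := ha
        obtain ⟨j, ⟨hj, hkj⟩, rfl⟩ := hb
        exact hw i j (by simp [elimNode, hi, hj, hik, hkj]))
    refine ⟨x, fun i j hij => ?_⟩
    by_cases hi : i = k
    · by_cases hj : j = k
      · simp_all
      · subst hi
        simpa [hj] using hhi (w j) (Finset.mem_image_of_mem w (by simp [hj, hij]))
    · by_cases hj : j = k
      · subst hj
        simpa [hi] using hlo (w i) (Finset.mem_image_of_mem w (by simp [hi, hij]))
      · simpa [hi, hj] using hw i j (by simp [elimNode, hi, hj, hij])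

theorem sat_closeNode_iff {ι : Type*} (k : ι) (R : ι → ι → Bool) (w : ι → ℝ) :
    Sat (closeNode k R) w ↔ Sat R w := by
  refine ⟨fun h i j hij => h i j (by simp [closeNode, hij]), fun h i j hij => ?_⟩
  simp only [closeNode, Bool.or_eq_true, Bool.and_eq_true] at hij
  rcases hij with h1 | ⟨h1, h2⟩
  · exact h _ _ h1
  · exact (h _ _ h1).trans (h _ _ h2)

/-- A choice of a cell in each of the two blocks spanned by two consecutive columns. -/
abbrev Letter : Type := Fin 2 → Fin 2 × Fin 2

/-- The cell at offset `l` (row, column) in the `i`-th block, as a pair (column, row). -/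
def blockCell (i : Fin 2) (l : Fin 2 × Fin 2) : Fin 2 × Fin 3 :=
  (l.2, ![i.castSucc, i.succ] l.1)

/-- The strict comparisons between the cells of two consecutive columns forced by a letter. -/
def letterRel (a : Letter) (p q : Fin 2 × Fin 3) : Bool :=
  decide (∃ i, q = blockCell i (a i) ∧ ∃ l, l ≠ a i ∧ p = blockCell i l)

/-- The eleven partial orders on a column that arise. -/
def columnPairs : Fin 11 → List (Fin 3 × Fin 3) :=
  ![[], [(2, 1)], [(1, 2)], [(0, 2), (1, 2)], [(1, 0), (2, 0)], [(1, 0)],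
    [(1, 0), (2, 0), (2, 1)], [(1, 0), (1, 2)], [(0, 1)], [(0, 1), (2, 1)],
    [(0, 1), (0, 2), (1, 2)]]

/-- The strict order relation of the partial order `s`. -/
def columnRel (s : Fin 11) (i j : Fin 3) : Bool := decide ((i, j) ∈ columnPairs s)

/-- The comparisons between two consecutive columns forced by the letter `a` and by the order `s`
on the second column. -/
def joinRel (s : Fin 11) (a : Letter) (p q : Fin 2 × Fin 3) : Bool :=
  letterRel a p q || (decide (p.1 = 1) && (decide (q.1 = 1) && columnRel s p.2 q.2))

/-- The comparisons that remain after eliminating the second column. -/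
def eliminated (s : Fin 11) (a : Letter) : Fin 2 × Fin 3 → Fin 2 × Fin 3 → Bool :=
  elimNode (1, 2) (elimNode (1, 1) (elimNode (1, 0) (joinRel s a)))

/-- The order induced on the first column. -/
def nextRel (s : Fin 11) (a : Letter) (i j : Fin 3) : Bool :=
  closeNode 2 (closeNode 1 (closeNode 0 fun i j => eliminated s a (0, i) (0, j))) i j

/-- The transition of the transfer matrix; `none` means that the comparisons are contradictory. -/
def step (s : Fin 11) (a : Letter) : Option (Fin 11) :=
  (List.finRange 11).find? fun t => decide (∀ i j, columnRel t i j = nextRel s a i j)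

theorem exists_loop_of_step_eq_none :
    ∀ (s : Fin 11) (a : Letter), step s a = none → ∃ i, nextRel s a i i = true := by
  decide +kernel

/-- Coefficients, in the basis `1, α, α²`, of the eigenvector of the transfer matrix. -/
def eigenCoeff : Option (Fin 11) → ℤ × ℤ × ℤ
  | none => (0, 0, 0)
  | some s => ![(2, 0, 0), (0, -10, 1), (-6, 21, -2), (0, -10, 1), (0, -10, 1), (-6, 21, -2),
      (1, 0, 0), (-5, 31, -3), (0, -10, 1), (7, -31, 3), (1, 0, 0)] s

theorem sum_eigenCoeff_step :
    ∀ s : Fin 11, ∑ a : Letter, eigenCoeff (step s a) =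
      (2 * (eigenCoeff (some s)).2.2, (eigenCoeff (some s)).1 - 9 * (eigenCoeff (some s)).2.2,
        (eigenCoeff (some s)).2.1 + 11 * (eigenCoeff (some s)).2.2) := by
  decide +kernel

theorem exists_columnRel_strictMono :
    ∀ s : Fin 11, ∃ f : Fin 3 → Fin 3, ∀ i j, columnRel s i j = true → f i < f j := by
  decide +kernel

theorem eliminated_left_or_loop : ∀ (s : Fin 11) (a : Letter) (p q : Fin 2 × Fin 3),
    eliminated s a p q = true →
      (p.1 = 0 ∧ q.1 = 0) ∨ ∃ i, eliminated s a (0, i) (0, i) = true := by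
  decide +kernel

/-- The weights on two consecutive columns. -/
def glueColumns (x y : Fin 3 → ℝ) (p : Fin 2 × Fin 3) : ℝ := ![x, y] p.1 p.2

theorem sat_eliminated_iff (s : Fin 11) (a : Letter) (w : Fin 2 × Fin 3 → ℝ) :
    Sat (eliminated s a) w ↔ ∃ u v x, Sat (joinRel s a)
      (Function.update (Function.update (Function.update w (1, 2) u) (1, 1) v) (1, 0) x) := by
  have h (k : Fin 3) : ((0, 0) : Fin 2 × Fin 3) ≠ (1, k) := by simp
  simp only [eliminated, ← exists_sat_update_iff _ (h _)]

theorem sat_columnRel_iff {s t : Fin 11} {a : Letter} (h : step s a = some t) (x : Fin 3 → ℝ) :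
    Sat (columnRel t) x ↔ Sat (nextRel s a) x := by
  have h' := List.find?_some h
  simp only [decide_eq_true_eq] at h'
  simp only [Sat, h']

theorem exists_sat_joinRel_iff (s : Fin 11) (a : Letter) (x : Fin 3 → ℝ) :
    (∃ y, Sat (joinRel s a) (glueColumns x y)) ↔ Sat (nextRel s a) x := by
  have h1 : Sat (nextRel s a) x ↔ Sat (eliminated s a) (glueColumns x 0) := by
    unfold nextRel
    rw [show (fun i j => closeNode 2 (closeNode 1 (closeNode 0 fun i j =>
      eliminated s a (0, i) (0, j))) i j) = closeNode 2 (closeNode 1 (closeNode 0 fun i j =>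
      eliminated s a (0, i) (0, j))) from rfl]
    rw [sat_closeNode_iff, sat_closeNode_iff, sat_closeNode_iff]
    refine ⟨fun h p q hpq => ?_, fun h i j hij => h (0, i) (0, j) hij⟩
    rcases eliminated_left_or_loop s a p q hpq with ⟨hp, hq⟩ | ⟨i, hi⟩
    · obtain ⟨c, i⟩ := p
      obtain ⟨d, j⟩ := q
      subst hp hq
      exact h i j hpq
    · exact absurd (h i i hi) (lt_irrefl _)
  rw [h1, sat_eliminated_iff]
  have h2 (u v z : ℝ) : Function.update (Function.update (Function.update
      (glueColumns x 0) (1, 2) u) (1, 1) v) (1, 0) z = glueColumns x ![z, v, u] := by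
    ext ⟨c, r⟩
    fin_cases c <;> fin_cases r <;> simp [Function.update, glueColumns]
  simp only [h2]
  constructor
  · rintro ⟨y, hy⟩
    refine ⟨y 2, y 1, y 0, ?_⟩
    convert hy
    ext i
    fin_cases i <;> rfl
  · rintro ⟨u, v, z, h⟩
    exact ⟨_, h⟩

theorem sat_joinRel_iff (s : Fin 11) (a : Letter) (x y : Fin 3 → ℝ) :
    Sat (joinRel s a) (glueColumns x y) ↔
      Sat (letterRel a) (glueColumns x y) ∧ Sat (columnRel s) y := by
  constructor
  · intro h
    refine ⟨fun p q hpq => h p q (by simp [joinRel, hpq]), fun i j hij => ?_⟩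
    exact h (1, i) (1, j) (by simp [joinRel, hij])
  · rintro ⟨h1, h2⟩ p q hpq
    simp only [joinRel, Bool.or_eq_true, Bool.and_eq_true, decide_eq_true_eq] at hpq
    rcases hpq with h | ⟨hp, hq, h⟩
    · exact h1 _ _ h
    · simpa [glueColumns, hp, hq] using h2 _ _ h

/-- The partial order induced on the first column by a word, if the word is realizable. -/
def wordState : (m : ℕ) → (Fin m → Letter) → Option (Fin 11)
  | 0, _ => some 0
  | m + 1, a => (wordState m (Fin.tail a)).bind fun s => step s (a 0)

/-- The column weights `w` are compatible with the choices of the word `a`. -/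
def WordSat {m : ℕ} (a : Fin m → Letter) (w : Fin (m + 1) → Fin 3 → ℝ) : Prop :=
  ∀ j, Sat (letterRel (a j)) (glueColumns (w j.castSucc) (w j.succ))

theorem wordSat_succ_iff {m : ℕ} (a : Fin (m + 1) → Letter) (w : Fin (m + 2) → Fin 3 → ℝ) :
    WordSat a w ↔ Sat (letterRel (a 0)) (glueColumns (w 0) (Fin.tail w 0)) ∧
      WordSat (Fin.tail a) (Fin.tail w) := by
  unfold WordSat
  rw [Fin.forall_fin_succ]
  rfl

theorem exists_wordSat_iff (m : ℕ) (a : Fin m → Letter) (x : Fin 3 → ℝ) :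
    (∃ w, WordSat a w ∧ w 0 = x) ↔ ∃ s ∈ wordState m a, Sat (columnRel s) x := by
  induction m generalizing x with
  | zero =>
    simp only [wordState, Option.mem_def, Option.some.injEq, exists_eq_left']
    refine ⟨fun _ i j hij => ?_, fun _ => ⟨fun _ => x, fun j => j.elim0, rfl⟩⟩
    simp [columnRel, columnPairs] at hij
  | succ m ih =>
    have h1 : (∃ w, WordSat a w ∧ w 0 = x) ↔ ∃ y, Sat (letterRel (a 0)) (glueColumns x y) ∧
        ∃ w, WordSat (Fin.tail a) w ∧ w 0 = y := by
      constructor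
      · rintro ⟨w, hw, rfl⟩
        rw [wordSat_succ_iff] at hw
        exact ⟨_, hw.1, _, hw.2, rfl⟩
      · rintro ⟨y, hy, w, hw, rfl⟩
        exact ⟨Fin.cons x w, (wordSat_succ_iff _ _).2 ⟨by simpa using hy, by simpa using hw⟩, rfl⟩
    rw [h1]
    simp only [ih, wordState, Option.mem_def, Option.bind_eq_some_iff]
    constructor
    · rintro ⟨y, hy, s, hs, hsy⟩
      have hx : Sat (nextRel s (a 0)) x :=
        (exists_sat_joinRel_iff _ _ _).1 ⟨y, (sat_joinRel_iff _ _ _ _).2 ⟨hy, hsy⟩⟩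
      cases ht : step s (a 0) with
      | none =>
        obtain ⟨i, hi⟩ := exists_loop_of_step_eq_none _ _ ht
        exact absurd (hx i i hi) (lt_irrefl _)
      | some t => exact ⟨t, ⟨s, hs, ht⟩, (sat_columnRel_iff ht x).2 hx⟩
    · rintro ⟨t, ⟨s, hs, ht⟩, htx⟩
      obtain ⟨y, hy⟩ := (exists_sat_joinRel_iff s (a 0) x).2 ((sat_columnRel_iff ht x).1 htx)
      rw [sat_joinRel_iff] at hy
      exact ⟨y, hy.1, s, hs, hy.2⟩

theorem exists_wordSat_iff_isSome (m : ℕ) (a : Fin m → Letter) :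
    (∃ w, WordSat a w) ↔ (wordState m a).isSome := by
  rw [Option.isSome_iff_exists]
  constructor
  · rintro ⟨w, hw⟩
    obtain ⟨s, hs, -⟩ := (exists_wordSat_iff m a (w 0)).1 ⟨w, hw, rfl⟩
    exact ⟨s, hs⟩
  · rintro ⟨s, hs⟩
    obtain ⟨f, hf⟩ := exists_columnRel_strictMono s
    obtain ⟨w, hw, -⟩ := (exists_wordSat_iff m a fun i => ((f i : ℕ) : ℝ)).2
      ⟨s, hs, fun i j hij => Nat.cast_lt.2 (hf i j hij)⟩
    exact ⟨w, hw⟩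

/-- The eigenvector of the transfer matrix for the eigenvalue `α`. -/
noncomputable def eigenWeight (α : ℝ) (s : Option (Fin 11)) : ℝ :=
  (eigenCoeff s).1 + (eigenCoeff s).2.1 * α + (eigenCoeff s).2.2 * α ^ 2

theorem sum_eigenWeight_step {α : ℝ} (hα : α ^ 3 = 11 * α ^ 2 - 9 * α + 2) (s : Option (Fin 11)) :
    ∑ a : Letter, eigenWeight α (s.bind fun s => step s a) = α * eigenWeight α s := by
  cases s with
  | none => simp [eigenWeight, eigenCoeff]
  | some s =>
    have h := sum_eigenCoeff_step s
    have h1 := congrArg Prod.fst h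
    have h2 := congrArg (fun z => z.2.1) h
    have h3 := congrArg (fun z => z.2.2) h
    simp only [Prod.fst_sum, Prod.snd_sum] at h1 h2 h3
    simp only [eigenWeight, Option.bind_some, Finset.sum_add_distrib, ← Finset.sum_mul]
    have h1' := congrArg (Int.cast : ℤ → ℝ) h1
    have h2' := congrArg (Int.cast : ℤ → ℝ) h2
    have h3' := congrArg (Int.cast : ℤ → ℝ) h3
    push_cast at h1' h2' h3'
    rw [h1', h2', h3']
    linear_combination -((eigenCoeff (some s)).2.2 : ℝ) * hα

theorem sum_eigenWeight_wordState {α : ℝ} (hα : α ^ 3 = 11 * α ^ 2 - 9 * α + 2) (m : ℕ) :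
    ∑ a : Fin m → Letter, eigenWeight α (wordState m a) = 2 * α ^ m := by
  induction m with
  | zero => simp [wordState, eigenWeight, eigenCoeff]
  | succ m ih =>
    rw [← (Fin.consEquiv fun _ : Fin (m + 1) => Letter).sum_comp, Fintype.sum_prod_type_right]
    have h (b : Fin m → Letter) : ∑ c : Letter, eigenWeight α
        (wordState (m + 1) (Fin.consEquiv (fun _ : Fin (m + 1) => Letter) (c, b))) =
          α * eigenWeight α (wordState m b) :=
      sum_eigenWeight_step hα _
    simp only [h, ← Finset.mul_sum, ih]
    ring

theorem eigenWeight_mem_Icc {α : ℝ} (h1 : 10.13 ≤ α) (h2 : α ≤ 10.14) (s : Fin 11) :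
    eigenWeight α (some s) ∈ Set.Icc (1 / 2) 2 := by
  have h3 : 0 ≤ (α - 10.13) * (10.14 - α) := mul_nonneg (by linarith) (by linarith)
  have h4 := sq_nonneg (α - 10.13)
  fin_cases s <;> norm_num [eigenWeight, eigenCoeff] at h1 h2 h3 h4 ⊢ <;> constructor <;> nlinarith

/-- The number of words whose choices are realized by some weights. -/
noncomputable def numWords (m : ℕ) : ℕ :=
  Nat.card {a : Fin m → Letter // ∃ w, WordSat a w}

theorem numWords_bounds {α : ℝ} (hα : α ^ 3 = 11 * α ^ 2 - 9 * α + 2) (h1 : 10.13 ≤ α)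
    (h2 : α ≤ 10.14) (m : ℕ) : α ^ m ≤ numWords m ∧ numWords m ≤ 4 * α ^ m := by
  classical
  have hcard : (numWords m : ℝ) =
      ∑ a : Fin m → Letter, if (wordState m a).isSome then (1 : ℝ) else 0 := by
    simp only [numWords, exists_wordSat_iff_isSome, Nat.card_eq_fintype_card,
      Fintype.card_subtype, Finset.sum_boole]
  have hsum := sum_eigenWeight_wordState hα m
  have hle (o : Option (Fin 11)) : eigenWeight α o ≤ 2 * (if o.isSome then (1 : ℝ) else 0) ∧
      1 / 2 * (if o.isSome then (1 : ℝ) else 0) ≤ eigenWeight α o := by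
    cases o with
    | none => simp [eigenWeight, eigenCoeff]
    | some s => simpa [and_comm] using eigenWeight_mem_Icc h1 h2 s
  have hu := Finset.sum_le_sum fun (a : Fin m → Letter) (_ : a ∈ Finset.univ) =>
    (hle (wordState m a)).1
  have hl := Finset.sum_le_sum fun (a : Fin m → Letter) (_ : a ∈ Finset.univ) =>
    (hle (wordState m a)).2
  rw [← Finset.mul_sum, ← hcard, hsum] at hu hl
  constructor <;> linarith

theorem tendsto_log_numWords {α : ℝ} (hα : α ^ 3 = 11 * α ^ 2 - 9 * α + 2) (h1 : 10.13 ≤ α)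
    (h2 : α ≤ 10.14) :
    Filter.Tendsto (fun m : ℕ => 1 / ((m + 1 : ℕ) : ℝ) * Real.log (numWords m)) Filter.atTop
      (nhds (Real.log α)) := by
  have hα0 : 0 < α := by linarith
  have hinv : Filter.Tendsto (fun m : ℕ => 1 / ((m + 1 : ℕ) : ℝ)) Filter.atTop (nhds 0) := by
    simpa using tendsto_one_div_add_atTop_nhds_zero_nat (𝕜 := ℝ)
  have hlow : Filter.Tendsto
      (fun m : ℕ => Real.log α - 1 / ((m + 1 : ℕ) : ℝ) * Real.log α) Filter.atTop
      (nhds (Real.log α)) := by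
    simpa using tendsto_const_nhds.sub (hinv.mul_const (Real.log α))
  have hupp : Filter.Tendsto
      (fun m : ℕ => Real.log α + 1 / ((m + 1 : ℕ) : ℝ) * (Real.log 4 - Real.log α)) Filter.atTop
      (nhds (Real.log α)) := by
    simpa using tendsto_const_nhds.add (hinv.mul_const (Real.log 4 - Real.log α))
  have hb := numWords_bounds hα h1 h2
  refine tendsto_of_tendsto_of_tendsto_of_le_of_le hlow hupp (fun m => ?_) fun m => ?_
  · have h := Real.log_le_log (pow_pos hα0 m) (hb m).1
    rw [Real.log_pow] at h
    have hm : (0 : ℝ) < ((m + 1 : ℕ) : ℝ) := by positivity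
    dsimp only
    rw [div_mul_eq_mul_div, div_mul_eq_mul_div, le_div_iff₀ hm, sub_mul, div_mul_cancel₀ _ hm.ne']
    push_cast
    linarith
  · have h := Real.log_le_log ((pow_pos hα0 m).trans_le (hb m).1) (hb m).2
    rw [Real.log_mul (by norm_num) (pow_pos hα0 m).ne', Real.log_pow] at h
    have hm : (0 : ℝ) < ((m + 1 : ℕ) : ℝ) := by positivity
    dsimp only
    rw [div_mul_eq_mul_div, div_mul_eq_mul_div, div_le_iff₀ hm, add_mul, div_mul_cancel₀ _ hm.ne']
    push_cast
    linarith

theorem cardano_root {α : ℝ}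
    (hα : α = (1 / 3) * (11 + ((1825 - 3 * Real.sqrt 921) / 2) ^ ((1 : ℝ) / 3)
            + ((1825 + 3 * Real.sqrt 921) / 2) ^ ((1 : ℝ) / 3))) :
    α ^ 3 = 11 * α ^ 2 - 9 * α + 2 ∧ 10.13 ≤ α ∧ α ≤ 10.14 := by
  have hs : Real.sqrt 921 ^ 2 = 921 := Real.sq_sqrt (by norm_num)
  have hs0 := Real.sqrt_nonneg 921
  have hs1 : Real.sqrt 921 ≤ 31 := by nlinarith
  have hu0 : 0 ≤ (1825 - 3 * Real.sqrt 921) / 2 := by linarith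
  have hv0 : 0 ≤ (1825 + 3 * Real.sqrt 921) / 2 := by linarith
  have cube {t : ℝ} (ht : 0 ≤ t) : (t ^ ((1 : ℝ) / 3)) ^ 3 = t := by
    rw [← Real.rpow_natCast, ← Real.rpow_mul ht]
    norm_num
  have huv : ((1825 - 3 * Real.sqrt 921) / 2) ^ ((1 : ℝ) / 3) *
      ((1825 + 3 * Real.sqrt 921) / 2) ^ ((1 : ℝ) / 3) = 94 := by
    rw [← Real.mul_rpow hu0 hv0,
      show (1825 - 3 * Real.sqrt 921) / 2 * ((1825 + 3 * Real.sqrt 921) / 2) = (94 : ℝ) ^ (3 : ℝ) by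
        norm_num
        linarith, ← Real.rpow_mul (by norm_num)]
    norm_num
  have hu3 := cube hu0
  have hv3 := cube hv0
  have hu := Real.rpow_nonneg hu0 (1 / 3)
  have hv := Real.rpow_nonneg hv0 (1 / 3)
  set u := ((1825 - 3 * Real.sqrt 921) / 2) ^ ((1 : ℝ) / 3)
  set v := ((1825 + 3 * Real.sqrt 921) / 2) ^ ((1 : ℝ) / 3)
  have hroot : α ^ 3 = 11 * α ^ 2 - 9 * α + 2 := by
    subst hα
    linear_combination (1 / 27) * hu3 + (1 / 27) * hv3 + (1 / 9) * (u + v) * huv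
  have h8 : 9 ≤ α := by
    have : 16 ≤ u + v := by nlinarith [sq_nonneg (u - v)]
    linarith
  refine ⟨hroot, ?_, ?_⟩
  · by_contra! h
    nlinarith [mul_pos (sub_pos.2 h) (sub_pos.2 h), mul_nonneg (sub_nonneg.2 h8) (sub_pos.2 h).le,
      mul_nonneg (mul_nonneg (sub_nonneg.2 h8) (sub_pos.2 h).le) (by linarith : (0:ℝ) ≤ α)]
  · by_contra! h
    nlinarith [mul_pos (sub_pos.2 h) (by linarith : (0:ℝ) < α),
      mul_pos (mul_pos (sub_pos.2 h) (by linarith : (0:ℝ) < α)) (by linarith : (0:ℝ) < α)]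

/-- The cell of the `3 × (m + 1)` grid at offset `l` in the block with top left corner `k`. -/
def gridCell {m : ℕ} (k : Fin 2 × Fin m) (l : Fin 2 × Fin 2) : Fin 3 × Fin (m + 1) :=
  (![k.1.castSucc, k.1.succ] l.1, ![k.2.castSucc, k.2.succ] l.2)

theorem gridCell_injective {m : ℕ} (k : Fin 2 × Fin m) : Function.Injective (gridCell k) := by
  have key {n : ℕ} (i : Fin n) : Function.Injective ![i.castSucc, i.succ] := by
    intro a b
    fin_cases a <;> fin_cases b <;> simp [Fin.ext_iff]
  intro l l' h
  rw [gridCell, gridCell, Prod.mk.injEq] at h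
  exact Prod.ext (key _ h.1) (key _ h.2)

theorem Qpolytope_succ (m : ℕ) : Qpolytope (m + 1) = simplexSum (gridCell (m := m)) := by
  unfold Qpolytope simplexSum
  rw [Fintype.sum_prod_type]
  refine Finset.sum_congr rfl fun i _ => Finset.sum_congr rfl fun j _ => congrArg _ ?_
  ext x
  simp only [Set.mem_insert_iff, Set.mem_singleton_iff, Set.mem_range, Prod.exists,
    Fin.exists_fin_two, simplexVertex, gridCell, eq_comm (a := x), or_assoc]
  rfl

theorem exists_realizes_gridCell_iff {m : ℕ} (f : Fin 2 × Fin m → Fin 2 × Fin 2) :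
    (∃ w, Realizes gridCell f w) ↔ ∃ w, WordSat (fun j i => f (i, j)) w := by
  have key (w : Fin (m + 1) → Fin 3 → ℝ) (i : Fin 2) (j : Fin m) (l : Fin 2 × Fin 2) :
      glueColumns (w j.castSucc) (w j.succ) (blockCell i l) =
        w (gridCell (i, j) l).2 (gridCell (i, j) l).1 := by
    obtain ⟨r, c⟩ := l
    fin_cases c <;> rfl
  have h (w : Fin (m + 1) → Fin 3 → ℝ) : Realizes gridCell f (fun c => w c.2 c.1) ↔
      WordSat (fun j i => f (i, j)) w := by
    constructor
    · intro hw j p q hpq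
      simp only [letterRel, decide_eq_true_eq] at hpq
      obtain ⟨i, rfl, l, hl, rfl⟩ := hpq
      rw [key, key]
      exact hw (i, j) l hl
    · rintro hw ⟨i, j⟩ l hl
      have := hw j (blockCell i l) (blockCell i (f (i, j)))
        (decide_eq_true ⟨i, rfl, l, hl, rfl⟩)
      rwa [key, key] at this
  exact ⟨fun ⟨w, hw⟩ => ⟨fun j i => w (i, j), (h _).1 hw⟩, fun ⟨w, hw⟩ => ⟨_, (h w).2 hw⟩⟩

theorem numVerticesQ_succ (m : ℕ) : numVerticesQ (m + 1) = numWords m := by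
  rw [numVerticesQ, Qpolytope_succ, card_extremePoints_simplexSum gridCell_injective, numWords]
  exact Nat.card_congr (Equiv.subtypeEquiv ((Equiv.curry _ _ _).trans (Equiv.piComm _))
    exists_realizes_gridCell_iff)

/-- the exponential growth rate of `V_n` is `ln α₂`, where
`α₂ = (1/3)·(11 + ((1825 − 3√921)/2)^{1/3} + ((1825 + 3√921)/2)^{1/3})`. -/
theorem numVerticesQ_asymptotics :
    Filter.Tendsto
      (fun n : ℕ => (1 / (n : ℝ)) * Real.log (numVerticesQ n))
      Filter.atTop
      (nhds (Real.log
        ((1 / 3) *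
          (11 + ((1825 - 3 * Real.sqrt 921) / 2) ^ ((1 : ℝ) / 3)
            + ((1825 + 3 * Real.sqrt 921) / 2) ^ ((1 : ℝ) / 3))))) := by
  obtain ⟨hα, h1, h2⟩ := cardano_root rfl
  rw [← Filter.tendsto_add_atTop_iff_nat 1]
  simpa only [numVerticesQ_succ] using tendsto_log_numWords hα h1 h2
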